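/- Let W be a singular discrete memoryless channel, and let (f,φ) be a blocklength-N code with message set M, codewords x^N(m) = f(m), decoding regions A_m = φ^{−1}(m), and |M| = ⌈e^{NR}⌉. Fix Q ∈ P(X) and z^N ∈ X^N, define α_y(Q) = Σ_{x: W(y|x)>0} Q(x) and S_R(Q) = { y^N : (1/N)Σ_{i=1}^N ln(1/α_{y_i}(Q)) ≤ R }, and assume that (a) W^N(S_R(Q)|x^N(m)) = W^N(S_R(Q)|z^N) for all m ∈ M, and (b) q_Q dominates W(·|x) for every x appearing in some codeword (i.e., q_Q(y) > 0 whenever W(y|x) > 0 for such x). Then the average error probability satisfies P̄_e(f,φ) ≥ W^N(S_R(Q)|z^N) − Σ_{y^N ∈ S_R(Q)} q_Q(y^N) · exp(−N[R − (1/N)Σ_{i=1}^N ln(1/α_{y_i}(Q))]), where q_Q(y^N) = Π_i q_Q(y_i). -/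

import Mathlib

open Real Finset

variable {X Y : Type} [Fintype X] [Fintype Y]

/-- A discrete memoryless channel: `W x y` is the probability of output `y` given input `x`. -/
def IsDMC (W : X → Y → ℝ) : Prop :=
  (∀ x y, 0 ≤ W x y) ∧ ∀ x, ∑ y, W x y = 1

/-- A probability distribution on a finite alphabet. -/
def IsProbDist (Q : X → ℝ) : Prop :=
  (∀ x, 0 ≤ Q x) ∧ ∑ x, Q x = 1

/-- Gallager symmetry: the output alphabet can be partitioned into classes such that within
each class every row is a permutation of every other row, and every column is a permutation
of every other column. -/
def GallagerSymmetric (W : X → Y → ℝ) : Prop :=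
  ∃ cls : Y → ℕ,
    (∀ (l : ℕ) (x x' : X),
        ((Finset.univ.filter fun y => cls y = l).val.map fun y => W x y) =
        ((Finset.univ.filter fun y => cls y = l).val.map fun y => W x' y)) ∧
    (∀ y y' : Y, cls y = cls y' →
        (Finset.univ.val.map fun x => W x y) = (Finset.univ.val.map fun x => W x y'))

/-- Singularity: whenever two inputs both give an output positive probability,
they give it the same probability. -/
def Singular (W : X → Y → ℝ) : Prop :=
  ∀ x z y, 0 < W x y * W z y → W x y = W z y

/-- Gallager's function `E_o(ρ, Q)`. -/
noncomputable def Eo (W : X → Y → ℝ) (Q : X → ℝ) (ρ : ℝ) : ℝ :=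
  - Real.log (∑ y, (∑ x, Q x * W x y ^ (1 / (1 + ρ))) ^ (1 + ρ))

/-- Mutual information `I(Q; W)`. -/
noncomputable def mutualInfo (W : X → Y → ℝ) (Q : X → ℝ) : ℝ :=
  ∑ x, ∑ y, Q x * W x y * Real.log (W x y / ∑ z, Q z * W z y)

/-- Channel capacity `C(W)`. -/
noncomputable def capacity (W : X → Y → ℝ) : ℝ :=
  sSup {r | ∃ Q, IsProbDist Q ∧ r = mutualInfo W Q}

/-- The set of values whose supremum is the sphere-packing exponent. -/
def ESPset (W : X → Y → ℝ) (R : ℝ) : Set ℝ :=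
  {e | ∃ Q, IsProbDist Q ∧ ∃ ρ : ℝ, 0 ≤ ρ ∧ e = Eo W Q ρ - ρ * R}

/-- The sphere-packing exponent `E_SP(R) = max_Q sup_{ρ ≥ 0} (E_o(ρ,Q) - ρ R)`. -/
noncomputable def ESP (W : X → Y → ℝ) (R : ℝ) : ℝ := sSup (ESPset W R)

/-- The random coding exponent `E_r(R) = max_Q max_{0 ≤ ρ ≤ 1} (E_o(ρ,Q) - ρ R)`. -/
noncomputable def Er (W : X → Y → ℝ) (R : ℝ) : ℝ :=
  sSup {e | ∃ Q, IsProbDist Q ∧ ∃ ρ : ℝ, 0 ≤ ρ ∧ ρ ≤ 1 ∧ e = Eo W Q ρ - ρ * R}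

/-- `R_∞`: the supremum of rates at which the sphere-packing exponent is infinite
(i.e. the defining supremum is unbounded). -/
noncomputable def Rinf (W : X → Y → ℝ) : ℝ :=
  sSup {R | ¬ BddAbove (ESPset W R)}

/-- The critical rate `R_cr`: the smallest rate above which `E_r = E_SP`. -/
noncomputable def Rcr (W : X → Y → ℝ) : ℝ :=
  sInf {R | ∀ R', R ≤ R' → Er W R' = ESP W R'}

/-- Number of messages of an `(N, R)` code: `⌈e^{NR}⌉`. -/
noncomputable def Mof (N : ℕ) (R : ℝ) : ℕ := ⌈Real.exp (N * R)⌉₊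

/-- Error probability of message `m` for a (non-feedback) block code. -/
noncomputable def msgErrorProb (W : X → Y → ℝ) {N M : ℕ}
    (f : Fin M → Fin N → X) (φ : (Fin N → Y) → Fin M) (m : Fin M) : ℝ :=
  ∑ y ∈ Finset.univ.filter (fun y : Fin N → Y => φ y ≠ m), ∏ n, W (f m n) (y n)

/-- Average error probability of a (non-feedback) block code. -/
noncomputable def avgErrorProb (W : X → Y → ℝ) {N M : ℕ}
    (f : Fin M → Fin N → X) (φ : (Fin N → Y) → Fin M) : ℝ :=
  (M : ℝ)⁻¹ * ∑ m, msgErrorProb W f φ m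

/-- A feedback encoder, given as a function of the whole output word, is causal if the symbol
sent at time `n` depends only on the message and the outputs at times `< n`. -/
def Causal {N M : ℕ} (f : Fin M → (Fin N → Y) → Fin N → X) : Prop :=
  ∀ m y y' n, (∀ k, k < n → y k = y' k) → f m y n = f m y' n

/-- Average error probability of a feedback code. -/
noncomputable def avgErrorProbFb (W : X → Y → ℝ) {N M : ℕ}
    (f : Fin M → (Fin N → Y) → Fin N → X) (φ : (Fin N → Y) → Fin M) : ℝ :=
  (M : ℝ)⁻¹ * ∑ m, ∑ y ∈ Finset.univ.filter (fun y : Fin N → Y => φ y ≠ m),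
      ∏ n, W (f m y n) (y n)

variable {X Y : Type} [Fintype X] [Fintype Y]

/-- `α_y(Q) = Σ_{x : W(y|x) > 0} Q(x)`. -/
noncomputable def alphaQ (W : X → Y → ℝ) (Q : X → ℝ) (y : Y) : ℝ :=
  ∑ x ∈ Finset.univ.filter (fun x => 0 < W x y), Q x

/-- The output distribution `q_Q` induced by input distribution `Q`. -/
noncomputable def qout (W : X → Y → ℝ) (Q : X → ℝ) (y : Y) : ℝ :=
  ∑ x, Q x * W x y

/-- `S_R(Q) = { y^N : (1/N) Σ_i ln (1/α_{y_i}(Q)) ≤ R }`. -/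
noncomputable def SsetQ (W : X → Y → ℝ) (Q : X → ℝ) (N : ℕ) (R : ℝ) :
    Finset (Fin N → Y) :=
  Finset.univ.filter fun y : Fin N → Y =>
    (N : ℝ)⁻¹ * ∑ i, Real.log (alphaQ W Q (y i))⁻¹ ≤ R

theorem qout_eq_of_singular {W : X → Y → ℝ} (hW : IsDMC W) (hsing : Singular W) (Q : X → ℝ)
    {x : X} {y : Y} (hx : 0 < W x y) : qout W Q y = alphaQ W Q y * W x y := by
  rw [qout, alphaQ, Finset.sum_mul, Finset.sum_filter]
  refine Finset.sum_congr rfl fun u _ => ?_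
  split_ifs with hu
  · rw [hsing u x y (mul_pos hu hx)]
  · rw [le_antisymm (not_lt.mp hu) (hW.1 u y), mul_zero]

/-- On a singular channel, a likelihood is at most the output probability over `α_y(Q)`. -/
theorem le_qout_mul_exp_log {W : X → Y → ℝ} (hW : IsDMC W) (hsing : Singular W) {Q : X → ℝ}
    (hQ : IsProbDist Q) {x : X} {y : Y} (h : 0 < W x y → 0 < qout W Q y) :
    W x y ≤ qout W Q y * Real.exp (Real.log (alphaQ W Q y)⁻¹) := by
  rcases (hW.1 x y).eq_or_lt with h0 | hx
  · rw [← h0]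
    exact mul_nonneg (Finset.sum_nonneg fun u _ => mul_nonneg (hQ.1 u) (hW.1 u y))
      (Real.exp_pos _).le
  · have hq := h hx
    rw [qout_eq_of_singular hW hsing Q hx] at hq ⊢
    have hα : 0 < alphaQ W Q y := pos_of_mul_pos_left hq hx.le
    rw [Real.exp_log (inv_pos.mpr hα)]
    field_simp
    exact le_rfl

/-- The probability of a set exceeds the error probability of a message by at most the
probability of correct decoding within the set. -/
theorem sum_sub_msgErrorProb_le {X Y : Type} [Fintype Y] {W : X → Y → ℝ} (hW : IsDMC W) {N M : ℕ}
    (f : Fin M → Fin N → X) (φ : (Fin N → Y) → Fin M) (S : Finset (Fin N → Y)) (m : Fin M) :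
    ∑ y ∈ S, ∏ n, W (f m n) (y n) - msgErrorProb W f φ m ≤
      ∑ y ∈ S, if φ y = m then ∏ n, W (f m n) (y n) else 0 := by
  have hsplit : ∑ y ∈ S, ∏ n, W (f m n) (y n) =
      (∑ y ∈ S, if φ y = m then ∏ n, W (f m n) (y n) else 0) +
        ∑ y ∈ S.filter (fun y => φ y ≠ m), ∏ n, W (f m n) (y n) := by
    rw [← Finset.sum_filter]
    exact (Finset.sum_filter_add_sum_filter_not S (fun y => φ y = m) _).symm
  have hle : ∑ y ∈ S.filter (fun y => φ y ≠ m), ∏ n, W (f m n) (y n) ≤ msgErrorProb W f φ m :=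
    Finset.sum_le_sum_of_subset_of_nonneg
      (Finset.filter_subset_filter _ (Finset.subset_univ S))
      fun y _ _ => Finset.prod_nonneg fun n _ => hW.1 _ _
  linarith

/-- **Lemma (multipurp)**: for a singular channel and any `(N,R)` code whose codewords all give
`S_R(Q)` the same probability `W^N(S_R(Q)|z^N)`, with `q_Q` dominating all rows used by the
code, the average error probability is at least
`W^N(S_R(Q)|z^N) − Σ_{y^N ∈ S_R(Q)} q_Q(y^N) exp(−N[R − (1/N)Σ_i ln(1/α_{y_i}(Q))])`. -/
theorem statement17 {X Y : Type} [Fintype X] [Fintype Y] [Nonempty X] [Nonempty Y]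
    (W : X → Y → ℝ) (hW : IsDMC W) (hsing : Singular W)
    (N : ℕ) (hN : 0 < N) (R : ℝ)
    (f : Fin (Mof N R) → Fin N → X) (φ : (Fin N → Y) → Fin (Mof N R))
    (Q : X → ℝ) (hQ : IsProbDist Q) (z : Fin N → X)
    (ha : ∀ m, ∑ y ∈ SsetQ W Q N R, ∏ n, W (f m n) (y n) =
      ∑ y ∈ SsetQ W Q N R, ∏ n, W (z n) (y n))
    (hb : ∀ m n y, 0 < W (f m n) y → 0 < qout W Q y) :
    avgErrorProb W f φ ≥
      (∑ y ∈ SsetQ W Q N R, ∏ n, W (z n) (y n)) -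
        ∑ y ∈ SsetQ W Q N R, (∏ i, qout W Q (y i)) *
          Real.exp (-(N : ℝ) * (R - (N : ℝ)⁻¹ * ∑ i, Real.log (alphaQ W Q (y i))⁻¹)) := by
  have hexp : Real.exp (N * R) ≤ (Mof N R : ℝ) := Nat.le_ceil _
  have hMpos : (0 : ℝ) < Mof N R := (Real.exp_pos _).trans_le hexp
  have hMinv : (Mof N R : ℝ)⁻¹ ≤ Real.exp (-(N * R)) := by
    rw [Real.exp_neg]
    exact inv_anti₀ (Real.exp_pos _) hexp
  set p := ∑ y ∈ SsetQ W Q N R, ∏ n, W (z n) (y n) with hp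
  have hsum : (Mof N R : ℝ) * p - ∑ m, msgErrorProb W f φ m ≤
      ∑ y ∈ SsetQ W Q N R, ∏ n, W (f (φ y) n) (y n) := by
    calc (Mof N R : ℝ) * p - ∑ m, msgErrorProb W f φ m
        = ∑ m, (∑ y ∈ SsetQ W Q N R, ∏ n, W (f m n) (y n) - msgErrorProb W f φ m) := by
          simp [Finset.sum_sub_distrib, ha]
      _ ≤ ∑ m, ∑ y ∈ SsetQ W Q N R, if φ y = m then ∏ n, W (f m n) (y n) else 0 :=
          Finset.sum_le_sum fun m _ => sum_sub_msgErrorProb_le hW f φ _ m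
      _ = ∑ y ∈ SsetQ W Q N R, ∏ n, W (f (φ y) n) (y n) := by
          rw [Finset.sum_comm]
          simp
  have hterm : ∀ y : Fin N → Y, (Mof N R : ℝ)⁻¹ * ∏ n, W (f (φ y) n) (y n) ≤
      (∏ i, qout W Q (y i)) *
        Real.exp (-(N : ℝ) * (R - (N : ℝ)⁻¹ * ∑ i, Real.log (alphaQ W Q (y i))⁻¹)) := by
    intro y
    have hN0 : (N : ℝ) ≠ 0 := by exact_mod_cast hN.ne'
    have hE : -(N : ℝ) * (R - (N : ℝ)⁻¹ * ∑ i, Real.log (alphaQ W Q (y i))⁻¹) =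
        -(N * R) + ∑ i, Real.log (alphaQ W Q (y i))⁻¹ := by
      field_simp
      ring
    rw [hE, Real.exp_add, Real.exp_sum, mul_left_comm, ← Finset.prod_mul_distrib]
    exact mul_le_mul hMinv
      (Finset.prod_le_prod (fun n _ => hW.1 _ _)
        fun n _ => le_qout_mul_exp_log hW hsing hQ (hb (φ y) n (y n)))
      (Finset.prod_nonneg fun n _ => hW.1 _ _) (Real.exp_pos _).le
  have hfinal := (mul_le_mul_of_nonneg_left hsum (inv_pos.mpr hMpos).le).trans
    ((Finset.mul_sum _ _ _).trans_le (Finset.sum_le_sum fun y _ => hterm y))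
  rw [mul_sub, inv_mul_cancel_left₀ hMpos.ne'] at hfinal
  rw [avgErrorProb]
  linarith
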